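/- arXiv:1708.05005 — 2 statements merged into one kernel-verified Lean document; each statement's English description precedes it below -/
import Mathlib

section
/- Exactness theorem (surjectivity of restriction to the isotropy group): let G be a group, a ∈ G, and let χ : C_G(a) → ℂ be an additive character on the centralizer of a, i.e. χ(g h) = χ(g) + χ(h) for all g, h ∈ G commuting with a. Then there exists a function T : G × G → ℂ such that: (i) for all b conjugate to a and all g₁, g₂ ∈ G, T(g₂g₁, b) = T(g₂, g₁ b g₁⁻¹) + T(g₁, b) (T is a character on the groupoid over the conjugacy class of a); and (ii) T(g, a) = χ(g) for every g commuting with a. -/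
/-- Exactness: every additive character `χ` on the centralizer `C_G(a)` extends to
a character `T` of the adjoint-action groupoid over the conjugacy class of `a`,
i.e. `T` is additive on composable morphisms over conjugates of `a` and restricts
to `χ` on the isotropy group at `a`. -/
theorem character_extension_from_isotropy
    (G : Type*) [Group G] (a : G)
    (χ : G → ℂ)
    (hχ : ∀ g h : G, g * a = a * g → h * a = a * h → χ (g * h) = χ g + χ h) :
    ∃ T : G → G → ℂ,
      (∀ b : G, IsConj a b →
        ∀ g₁ g₂ : G, T (g₂ * g₁) b = T g₂ (g₁ * b * g₁⁻¹) + T g₁ b) ∧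
      (∀ g : G, g * a = a * g → T g a = χ g) := by
  classical
  have hsection : ∀ b : G, ∃ c : G, IsConj a b → SemiconjBy c a b := by
    intro b
    by_cases hb : IsConj a b
    · obtain ⟨c, hc⟩ := isConj_iff.mp hb
      exact ⟨c, fun _ => (mul_inv_eq_iff_eq_mul.mp hc)⟩
    · exact ⟨1, fun h => absurd h hb⟩
  choose s hs using hsection
  have hconj : ∀ g b : G, SemiconjBy g b (g * b * g⁻¹) := fun g b => SemiconjBy.conj_mk g b
  have hloop : ∀ b : G, IsConj a b → ∀ g : G,
      Commute ((s (g * b * g⁻¹))⁻¹ * g * s b) a := by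
    intro b hb g
    have hgb : IsConj a (g * b * g⁻¹) := hb.trans (isConj_iff.mpr ⟨g, rfl⟩)
    exact ((hs _ hgb).inv_symm_left.mul_left (hconj g b)).mul_left (hs b hb)
  refine ⟨fun g b => χ ((s (g * b * g⁻¹))⁻¹ * g * s b), ?_, ?_⟩
  · intro b hb g₁ g₂
    have hb₁ : IsConj a (g₁ * b * g₁⁻¹) := hb.trans (isConj_iff.mpr ⟨g₁, rfl⟩)
    have htarget : g₂ * g₁ * b * (g₂ * g₁)⁻¹ = g₂ * (g₁ * b * g₁⁻¹) * g₂⁻¹ := by group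
    dsimp only
    rw [← hχ _ _ (hloop _ hb₁ g₂) (hloop b hb g₁), htarget]
    congr 1
    group
  · intro g hg
    have hfix : g * a * g⁻¹ = a := mul_inv_eq_iff_eq_mul.mpr hg
    have hsa : Commute (s a) a := hs a (IsConj.refl a)
    have hga : Commute g a := hg
    have hone : χ 1 = 0 := by
      simpa using hχ 1 1 (Commute.one_left a) (Commute.one_left a)
    have hinv : χ (s a)⁻¹ + χ (s a) = 0 := by
      rw [← hχ _ _ hsa.inv_left hsa, inv_mul_cancel, hone]
    dsimp only
    rw [hfix, hχ _ _ (hsa.inv_left.mul_left hga) hsa, hχ _ _ hsa.inv_left hga]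
    linear_combination hinv
end

section
/- Let G be a group and χ : G → ℂ a nonzero additive character (χ(gh) = χ(g) + χ(h) for all g,h, and χ(g₀) ≠ 0 for some g₀ ∈ G). Then the derivation X of C[G] defined by X(g) = χ(g)·g on basis elements is not an inner derivation: there is no u ∈ C[G] with X(v) = u·v − v·u for all v ∈ C[G]. -/
/-- If `χ : G → ℂ` is a nonzero additive character, then the derivation `X` of
`ℂ[G]` defined on basis elements by `X(g) = χ(g)·g` is not an inner derivation. -/
theorem derivation_from_nonzero_character_not_inner
    (G : Type*) [Group G]
    (χ : G → ℂ) (hχ : ∀ g h : G, χ (g * h) = χ g + χ h)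
    (g₀ : G) (hg₀ : χ g₀ ≠ 0)
    (X : MonoidAlgebra ℂ G →ₗ[ℂ] MonoidAlgebra ℂ G)
    (hX : ∀ g : G, X (MonoidAlgebra.single g 1) = χ g • MonoidAlgebra.single g 1) :
    ¬ ∃ u : MonoidAlgebra ℂ G, ∀ v : MonoidAlgebra ℂ G, X v = u * v - v * u := by
  rintro ⟨u, hu⟩
  apply hg₀
  have h := congrArg (fun w => w.coeff g₀) ((hX g₀).symm.trans (hu _))
  simpa using h
end
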